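/- arXiv:nlin/0204029 — 14 statements merged into one kernel-verified Lean document; each statement's English description precedes it below -/
import Mathlib

section
/- Let A be a commutative ring, Ω an A-module, and N : Ω → Ω an A-linear map. Let n ≥ 1, let λ : Fin n → A, and let ξ, η, ω : Fin n → Ω satisfy N(ξ i) = λ i • ξ i and N(η i) = λ i • η i for every i. Suppose J is an invertible n×n matrix over A and a, b : Fin n → A are such that a i • ξ i + b i • η i + Σ_j (J i j) • ω j = 0 for every i. Then for every i, N(ω i) = Σ_j ((J⁻¹ * D * J) i j) • ω j, where D is the diagonal matrix with diagonal entries λ. (This is the algebraic core of the paper's Proposition: Hamiltonians separable in Darboux–Nijenhuis coordinates span an N*-invariant distribution with control matrix F = J⁻¹ΛJ.) -/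
theorem Matrix.sum_mul_apply_smul {A Ω ι κ μ : Type*} [CommRing A] [AddCommGroup Ω] [Module A Ω]
    [Fintype κ] [Fintype μ] (P : Matrix ι κ A) (Q : Matrix κ μ A) (v : μ → Ω) (i : ι) :
    ∑ j, (P * Q) i j • v j = ∑ k, P i k • ∑ j, Q k j • v j := by
  simp only [Matrix.mul_apply, Finset.sum_smul, Finset.smul_sum, mul_smul]
  exact Finset.sum_comm

/-- Hamiltonians separable in Darboux–Nijenhuis coordinates span an
N*-invariant distribution with control matrix `F = J⁻¹ Λ J`. -/
theorem stmt_0 {A : Type*} [CommRing A] {Ω : Type*} [AddCommGroup Ω] [Module A Ω]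
    (N : Ω →ₗ[A] Ω) (n : ℕ) (hn : 1 ≤ n) (lam : Fin n → A)
    (ξ η ω : Fin n → Ω)
    (hξ : ∀ i, N (ξ i) = lam i • ξ i) (hη : ∀ i, N (η i) = lam i • η i)
    (J : Matrix (Fin n) (Fin n) A) (hJ : IsUnit J.det)
    (a b : Fin n → A)
    (hsep : ∀ i, a i • ξ i + b i • η i + ∑ j, J i j • ω j = 0) :
    ∀ i, N (ω i) = ∑ j, (J⁻¹ * Matrix.diagonal lam * J) i j • ω j := by
  have hN (k : Fin n) : N (∑ j, J k j • ω j) = lam k • ∑ j, J k j • ω j := by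
    rw [eq_neg_of_add_eq_zero_right (hsep k)]
    simp only [map_neg, map_add, map_smul, hξ, hη, smul_neg, smul_add, smul_comm (lam k)]
  intro i
  have hω : ω i = ∑ k, J⁻¹ i k • ∑ j, J k j • ω j := by
    rw [← Matrix.sum_mul_apply_smul, Matrix.nonsing_inv_mul J hJ]
    simp [Matrix.one_apply]
  rw [hω, Matrix.mul_assoc, Matrix.sum_mul_apply_smul]
  rw [map_sum]
  refine Finset.sum_congr rfl fun k _ => ?_
  rw [map_smul, hN]
  simp only [Matrix.diagonal_mul, mul_smul, Finset.smul_sum]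
end

section
/- Let A be a commutative ring and D : A → A an additive map satisfying the Leibniz rule D(fg) = f·D(g) + g·D(f). Let n ≥ 1, f ∈ A, and a : Fin n → A with D(a j) = 0 for every j, and suppose D^n f = Σ_{j=0}^{n−1} a j · D^j f. Let ν ∈ A satisfy D ν = 0 and ν^n = Σ_{j=0}^{n−1} a j · ν^j. Define w_{n−1} := 1 and w_k := ν^{n−k−1} − Σ_{j=0}^{n−k−2} a_{k+j+1} · ν^j for 0 ≤ k ≤ n−2, and set g := Σ_{j=0}^{n−1} w_j · D^j f. Then D g = ν · g. -/
theorem map_pow_eq_zero_of_leibniz {A : Type*} [CommRing A] (D : A →+ A)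
    (hD : ∀ f g : A, D (f * g) = f * D g + g * D f) {x : A} (hx : D x = 0) (k : ℕ) :
    D (x ^ k) = 0 := by
  induction k with
  | zero => simpa using hD 1 1
  | succ k ih => rw [pow_succ, hD, hx, ih, mul_zero, mul_zero, add_zero]

/-- if the action of the derivation `D` on `f` closes linearly with
`D`-invariant coefficients `a`, and `ν` is a root of the associated characteristic
polynomial with `D ν = 0`, then `g = ∑ w j • D^[j] f` (with `w` the corresponding
left eigenvector of the companion matrix) satisfies `D g = ν · g`. -/
theorem stmt_4 {A : Type*} [CommRing A] (D : A →+ A)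
    (hD : ∀ f g : A, D (f * g) = f * D g + g * D f)
    (n : ℕ) (hn : 1 ≤ n) (f : A) (a : Fin n → A)
    (ha : ∀ j, D (a j) = 0)
    (hf : (⇑D)^[n] f = ∑ j : Fin n, a j * (⇑D)^[j.val] f)
    (ν : A) (hν : D ν = 0) (hνeq : ν ^ n = ∑ j : Fin n, a j * ν ^ j.val)
    (w : Fin n → A)
    (hw : ∀ k : Fin n, w k = ν ^ (n - 1 - k.val) -
      ∑ j : Fin (n - 1 - k.val),
        a ⟨k.val + j.val + 1, by have h1 := j.isLt; have h2 := k.isLt; omega⟩ * ν ^ j.val) :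
    D (∑ j : Fin n, w j * (⇑D)^[j.val] f) = ν * ∑ j : Fin n, w j * (⇑D)^[j.val] f := by
  obtain ⟨m, rfl⟩ : ∃ m, n = m + 1 := ⟨n - 1, by omega⟩
  have hDw : ∀ k, D (w k) = 0 := by
    intro k
    have hpow := map_pow_eq_zero_of_leibniz D hD hν
    simp [hw, hD, ha, hpow]
  obtain ⟨b, hb⟩ : ∃ b : ℕ → A, ∀ j : Fin (m + 1), a j = b j.val :=
    ⟨fun i => if h : i < m + 1 then a ⟨i, h⟩ else 0, fun j => by simp only [j.isLt, dif_pos, Fin.eta]⟩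
  have hw' : ∀ k : Fin (m + 1), w k = ν ^ (m - k.val) -
      ∑ j ∈ Finset.range (m - k.val), b (k.val + j + 1) * ν ^ j := by
    intro k
    rw [hw k, Finset.sum_range]
    simp only [hb]
    rfl
  have hlast : w (Fin.last m) = 1 := by simp [hw']
  have hstep : ∀ i : Fin m, ν * w i.succ = w i.castSucc + a i.succ := by
    intro i
    have hi : m - i.val = (m - (i.val + 1)) + 1 := by omega
    rw [hw', hw', hb, Fin.val_castSucc, Fin.val_succ, hi, Finset.sum_range_succ', mul_sub,
      Finset.mul_sum, pow_succ']
    have hsum : ∑ j ∈ Finset.range (m - (i.val + 1)), ν * (b (i.val + 1 + j + 1) * ν ^ j) =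
        ∑ j ∈ Finset.range (m - (i.val + 1)), b (i.val + (j + 1) + 1) * ν ^ (j + 1) :=
      Finset.sum_congr rfl fun j _ => by
        rw [show i.val + 1 + j + 1 = i.val + (j + 1) + 1 by omega]
        ring
    rw [hsum, pow_zero, mul_one, add_zero]
    ring
  have hzero : ν * w 0 = a 0 := by
    rw [hw', mul_sub, Finset.mul_sum, Finset.sum_range]
    rw [Fin.sum_univ_succ, pow_succ'] at hνeq
    simp only [hb, Fin.val_zero, Fin.val_succ, Nat.sub_zero, zero_add, pow_zero, mul_one]
      at hνeq ⊢
    rw [hνeq, add_sub_assoc, add_eq_left, sub_eq_zero]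
    exact Finset.sum_congr rfl fun j _ => by ring
  have hDg : D (∑ j : Fin (m + 1), w j * (⇑D)^[j.val] f) =
      ∑ j : Fin (m + 1), w j * (⇑D)^[j.val + 1] f := by
    simp only [map_sum, hD, hDw, mul_zero, add_zero, Function.iterate_succ_apply']
  rw [hDg, Fin.sum_univ_castSucc, Fin.val_last, hlast, hf, one_mul, Fin.sum_univ_succ,
    Fin.sum_univ_succ, mul_add, ← mul_assoc, hzero, add_left_comm, ← Finset.sum_add_distrib,
    Finset.mul_sum]
  congr 1
  refine Finset.sum_congr rfl fun i _ => ?_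
  rw [← mul_assoc, hstep, add_mul, Fin.val_castSucc, Fin.val_succ]
end

section
/- Let A be a commutative ring, Ω an A-module, d : A → Ω an additive map satisfying the Leibniz rule d(fg) = f·d(g) + g·d(f), and N : Ω → Ω an A-linear map. Let p and Δ be polynomials with coefficients in A, let α ∈ Ω, and suppose that for every m ≥ 0, N(d(p.coeff m)) = d(p.coeff (m−1)) + (Δ.coeff m) • α, where p.coeff(−1) := 0 (this encodes the relation N* d f(λ) = λ d f(λ) + Δ(λ) α coefficientwise). Let λ₀ ∈ A satisfy Δ.eval λ₀ = 0 and N(d λ₀) = λ₀ • d λ₀. Then N( d( p.eval λ₀ ) ) = λ₀ • d( p.eval λ₀ ). -/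
/-- Powers of an eigenfunction are eigenfunctions for the same eigenvalue. -/
theorem map_leibniz_pow_eq_smul {A : Type*} [CommRing A] {Ω : Type*} [AddCommGroup Ω] [Module A Ω]
    (d : A →+ Ω) (hd : ∀ f g : A, d (f * g) = f • d g + g • d f)
    (N : Ω →ₗ[A] Ω) {a : A} (ha : N (d a) = a • d a) (n : ℕ) :
    N (d (a ^ n)) = a • d (a ^ n) := by
  induction n with
  | zero =>
    have h1 : d 1 = 0 := by simpa using hd 1 1
    simp [h1]
  | succ n ih =>
    rw [pow_succ, hd, map_add, map_smul, map_smul, ih, ha]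
    module

/-- The recursion for the coefficients, summed over the terms of degree less than `n`. -/
theorem map_leibniz_sum_range {A : Type*} [CommRing A] {Ω : Type*} [AddCommGroup Ω] [Module A Ω]
    (d : A →+ Ω) (hd : ∀ f g : A, d (f * g) = f • d g + g • d f)
    (N : Ω →ₗ[A] Ω) (c δ : ℕ → A) (α : Ω)
    (hrec : ∀ m : ℕ, N (d (c m)) = (if m = 0 then 0 else d (c (m - 1))) + δ m • α)
    {a : A} (ha : N (d a) = a • d a) (n : ℕ) :
    N (d (∑ m ∈ Finset.range n, c m * a ^ m)) + a ^ n • (if n = 0 then 0 else d (c (n - 1))) =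
      a • d (∑ m ∈ Finset.range n, c m * a ^ m) +
        (∑ m ∈ Finset.range n, δ m * a ^ m) • α := by
  induction n with
  | zero => simp
  | succ n ih =>
    simp only [Finset.sum_range_succ, map_add, hd (c n), map_smul,
      map_leibniz_pow_eq_smul d hd N ha, hrec n, Nat.add_one_ne_zero, if_false,
      Nat.add_sub_cancel]
    linear_combination (norm := module) ih

/-- Stäckel function generators. If the coefficients of `p` satisfy
`N (d (p.coeff m)) = d (p.coeff (m-1)) + (Δ.coeff m) • α` (with `p.coeff (-1) := 0`),
and `λ₀` is a root of `Δ` with `N (d λ₀) = λ₀ • d λ₀`, then the evaluation `p.eval λ₀`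
is a Stäckel function relative to `λ₀`. -/
theorem stmt_5 {A : Type*} [CommRing A] {Ω : Type*} [AddCommGroup Ω] [Module A Ω]
    (d : A →+ Ω) (hd : ∀ f g : A, d (f * g) = f • d g + g • d f)
    (N : Ω →ₗ[A] Ω) (p Δ : Polynomial A) (α : Ω)
    (hrec : ∀ m : ℕ, N (d (p.coeff m)) =
      (if m = 0 then 0 else d (p.coeff (m - 1))) + Δ.coeff m • α)
    (lam0 : A) (hroot : Δ.eval lam0 = 0) (heig : N (d lam0) = lam0 • d lam0) :
    N (d (p.eval lam0)) = lam0 • d (p.eval lam0) := by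
  have hp : p.natDegree < p.natDegree + Δ.natDegree + 2 := by omega
  have hΔ : Δ.natDegree < p.natDegree + Δ.natDegree + 2 := by omega
  have hlast : p.coeff (p.natDegree + Δ.natDegree + 2 - 1) = 0 :=
    Polynomial.coeff_eq_zero_of_natDegree_lt (by omega)
  have h := map_leibniz_sum_range d hd N p.coeff Δ.coeff α hrec heig
    (p.natDegree + Δ.natDegree + 2)
  rw [← Polynomial.eval_eq_sum_range' hp, ← Polynomial.eval_eq_sum_range' hΔ, hroot, hlast] at h
  simpa using h
end

section
/- Let A be a commutative ring, Ω an A-module, d : A → Ω an additive map satisfying the Leibniz rule d(fg) = f·d(g) + g·d(f), and N : Ω → Ω an A-linear map. Let n ≥ 1, λ : Fin n → A, and let S be an invertible n×n matrix over A with N(d(S i j)) = λ i • d(S i j) for all i, j. Let H, U : Fin n → A satisfy U i = Σ_j (S i j)·(H j) and N(d(U i)) = λ i • d(U i) for all i, and let F be an n×n matrix over A with N(d(H i)) = Σ_j (F i j) • d(H j) for all i. If the family (d(H 1), …, d(H n)) is linearly independent over A, then F = S⁻¹ * D * S, where D is the diagonal matrix with diagonal entries λ. -/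
/-- the control matrix of a Stäckel basis is diagonalized by the
Stäckel matrix: `F = S⁻¹ Λ S`. -/
theorem stmt_6 {A : Type*} [CommRing A] {Ω : Type*} [AddCommGroup Ω] [Module A Ω]
    (d : A →+ Ω) (hd : ∀ f g : A, d (f * g) = f • d g + g • d f)
    (N : Ω →ₗ[A] Ω) (n : ℕ) (hn : 1 ≤ n) (lam : Fin n → A)
    (S : Matrix (Fin n) (Fin n) A) (hS : IsUnit S.det)
    (hSe : ∀ i j, N (d (S i j)) = lam i • d (S i j))
    (H U : Fin n → A)
    (hU : ∀ i, U i = ∑ j, S i j * H j)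
    (hUe : ∀ i, N (d (U i)) = lam i • d (U i))
    (F : Matrix (Fin n) (Fin n) A)
    (hF : ∀ i, N (d (H i)) = ∑ j, F i j • d (H j))
    (hind : LinearIndependent A fun i => d (H i)) :
    F = S⁻¹ * Matrix.diagonal lam * S := by
  have hdU (i : Fin n) : d (U i) = ∑ j, S i j • d (H j) + ∑ j, H j • d (S i j) := by
    simp only [hU, map_sum, hd, Finset.sum_add_distrib]
  have hN (i : Fin n) : ∑ j, S i j • N (d (H j)) = lam i • ∑ j, S i j • d (H j) := by
    have h := hUe i
    simp only [hdU, map_add, map_sum, map_smul, hSe, smul_add] at h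
    have hswap : ∑ j, H j • lam i • d (S i j) = lam i • ∑ j, H j • d (S i j) := by
      simp only [Finset.smul_sum, smul_comm (lam i)]
    rw [hswap] at h
    exact add_right_cancel h
  have hSF : S * F = Matrix.diagonal lam * S := by
    ext i k
    refine congrFun (hind.fintypeLinearCombination_injective (a₁ := (S * F) i)
      (a₂ := (Matrix.diagonal lam * S) i) ?_) k
    have h := hN i
    simp only [hF, Finset.smul_sum, smul_smul] at h
    rw [Finset.sum_comm] at h
    simp only [Fintype.linearCombination_apply, Matrix.diagonal_mul]
    simpa only [Matrix.mul_apply, Finset.sum_smul] using h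
  rw [Matrix.mul_assoc, ← hSF, Matrix.nonsing_inv_mul_cancel_left S F hS]
end

section
/- Let A be a commutative ring, Ω an A-module, d : A → Ω an additive map satisfying the Leibniz rule d(fg) = f·d(g) + g·d(f), and N : Ω → Ω an A-linear map. Let n ≥ 1 and λ : Fin n → A with N(d(λ i)) = λ i • d(λ i) for every i, and let S be an invertible n×n matrix over A with N(d(S i j)) = λ i • d(S i j) for all i, j. Set F := S⁻¹ * D * S, where D is the diagonal matrix with diagonal entries λ. Then N(d(F i j)) = Σ_k (F i k) • d(F k j) for all i, j. -/
/-- The action of a composite matrix on a tuple of vectors in a module. -/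
theorem Matrix.sum_mul_smul {A Ω l m n : Type*} [Semiring A] [AddCommMonoid Ω] [Module A Ω]
    [Fintype m] [Fintype n] (P : Matrix l m A) (Q : Matrix m n A) (x : n → Ω) (i : l) :
    ∑ k, (P * Q) i k • x k = ∑ j, P i j • ∑ k, Q j k • x k := by
  simp only [Matrix.mul_apply, Finset.sum_smul, Finset.smul_sum, mul_smul]
  exact Finset.sum_comm

/-- An invertible matrix acts injectively on tuples of vectors in a module. -/
theorem Matrix.eq_of_sum_smul_eq {A Ω n : Type*} [CommRing A] [AddCommGroup Ω] [Module A Ω]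
    [Fintype n] [DecidableEq n] {S : Matrix n n A} (hS : IsUnit S.det) {x y : n → Ω}
    (h : ∀ i, ∑ k, S i k • x k = ∑ k, S i k • y k) : x = y := by
  have key (z : n → Ω) (i : n) : z i = ∑ j, S⁻¹ i j • ∑ k, S j k • z k := by
    rw [← Matrix.sum_mul_smul, Matrix.nonsing_inv_mul S hS]
    simp [Matrix.one_apply, ite_smul]
  funext i
  rw [key x, key y]
  simp only [h]


/-- necessity of the Stäckel separability condition: if `S` is a Stäckel
matrix (`N (d S_{ij}) = λ i • d S_{ij}`) and the eigenvalues satisfy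
`N (d λ_i) = λ i • d λ_i`, then the control matrix `F = S⁻¹ Λ S` satisfies
`N dF = F dF`. -/
theorem stmt_7 {A : Type*} [CommRing A] {Ω : Type*} [AddCommGroup Ω] [Module A Ω]
    (d : A →+ Ω) (hd : ∀ f g : A, d (f * g) = f • d g + g • d f)
    (N : Ω →ₗ[A] Ω) (n : ℕ) (hn : 1 ≤ n) (lam : Fin n → A)
    (hlam : ∀ i, N (d (lam i)) = lam i • d (lam i))
    (S : Matrix (Fin n) (Fin n) A) (hS : IsUnit S.det)
    (hSe : ∀ i j, N (d (S i j)) = lam i • d (S i j)) :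
    ∀ i j, N (d ((S⁻¹ * Matrix.diagonal lam * S) i j)) =
      ∑ k, (S⁻¹ * Matrix.diagonal lam * S) i k • d ((S⁻¹ * Matrix.diagonal lam * S) k j) := by
  set F := S⁻¹ * Matrix.diagonal lam * S with hF
  have hSF : S * F = Matrix.diagonal lam * S := by
    rw [hF, Matrix.mul_assoc, Matrix.mul_nonsing_inv_cancel_left _ _ hS]
  intro i j
  refine congrFun (Matrix.eq_of_sum_smul_eq hS (x := fun k => N (d (F k j)))
    (y := fun k => ∑ l, F k l • d (F l j)) fun i => ?_) i
  have hdF : ∑ k, S i k • d (F k j) =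
      lam i • d (S i j) + S i j • d (lam i) - ∑ k, F k j • d (S i k) := by
    have h := congrArg d (congrFun (congrFun hSF i) j)
    rw [Matrix.diagonal_mul, Matrix.mul_apply, map_sum, hd] at h
    simp only [hd, Finset.sum_add_distrib] at h
    exact eq_sub_of_add_eq h
  calc ∑ k, S i k • N (d (F k j))
      = N (∑ k, S i k • d (F k j)) := by simp only [map_sum, map_smul]
    _ = lam i • ∑ k, S i k • d (F k j) := by
        rw [hdF]
        simp only [map_sub, map_add, map_sum, map_smul, hSe, hlam, smul_sub, smul_add,
          Finset.smul_sum, smul_comm (lam i)]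
    _ = ∑ k, (S * F) i k • d (F k j) := by
        simp only [hSF, Matrix.diagonal_mul, Finset.smul_sum, mul_smul]
    _ = ∑ k, S i k • ∑ l, F k l • d (F l j) :=
        Matrix.sum_mul_smul S F (fun l => d (F l j)) i
end

section
/- Let A be a commutative ring, Ω an A-module, d : A → Ω an additive map satisfying the Leibniz rule d(fg) = f·d(g) + g·d(f), and N : Ω → Ω an A-linear map. Let n ≥ 1 and λ : Fin n → A with λ i − λ j a unit of A whenever i ≠ j and with N(d(λ i)) = λ i • d(λ i) for every i. Let S be an invertible n×n matrix over A such that for every row i there exists a column k with S i k = 1, and set F := S⁻¹ * D * S, where D is the diagonal matrix with diagonal entries λ. If N(d(F i j)) = Σ_k (F i k) • d(F k j) for all i, j, then N(d(S i j)) = λ i • d(S i j) for all i, j. -/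
/-- If a row vector `v` with entries in a module satisfies `v F ≡ μᵢ v` modulo a submodule `K`, where
`F = S⁻¹ diag(μ) S` has eigenvalues with unit differences, then `v` is congruent to a multiple of
the `i`-th row of `S`; hence it lies in `K` as soon as one entry does where that row equals `1`. -/
theorem mem_of_smul_sub_sum_smul_mem {ι A Ω : Type*} [Fintype ι] [DecidableEq ι] [CommRing A]
    [AddCommGroup Ω] [Module A Ω] (K : Submodule A Ω) (μ : ι → A) (S F : Matrix ι ι A)
    (hS : IsUnit S.det) (hF : F * S⁻¹ = S⁻¹ * Matrix.diagonal μ) (i k : ι)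
    (hμ : ∀ j, i ≠ j → IsUnit (μ i - μ j)) (v : ι → Ω)
    (hv : ∀ l, μ i • v l - ∑ m, F m l • v m ∈ K) (hk : v k ∈ K) (hSk : S i k = 1) (l : ι) :
    v l ∈ K := by
  let θ : ι → Ω := fun j => ∑ m, S⁻¹ m j • v m
  have hθ (j : ι) (hj : i ≠ j) : θ j ∈ K := by
    have hsum : ∑ l, S⁻¹ l j • (μ i • v l - ∑ m, F m l • v m) = (μ i - μ j) • θ j := by
      have hcol (m : ι) : ∑ l, F m l * S⁻¹ l j = S⁻¹ m j * μ j := by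
        rw [← Matrix.mul_apply, hF, Matrix.mul_diagonal]
      have hswap : ∑ l, S⁻¹ l j • ∑ m, F m l • v m = μ j • θ j := by
        simp only [θ, Finset.smul_sum, smul_smul]
        rw [Finset.sum_comm]
        refine Finset.sum_congr rfl fun m _ => ?_
        rw [← Finset.sum_smul, mul_comm (μ j), ← hcol]
        simp only [mul_comm]
      simp only [smul_sub, Finset.sum_sub_distrib, sub_smul, hswap]
      simp only [θ, Finset.smul_sum, smul_smul, mul_comm]
    rw [← Submodule.smul_mem_iff_of_isUnit K (hμ j hj), ← hsum]
    exact K.sum_mem fun l _ => K.smul_mem _ (hv l)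
  have hexpand (l : ι) : v l = ∑ j, S j l • θ j := by
    simp only [θ, Finset.smul_sum, smul_smul]
    rw [Finset.sum_comm]
    have hone (m : ι) : ∑ j, S j l * S⁻¹ m j = (1 : Matrix ι ι A) m l := by
      rw [← Matrix.nonsing_inv_mul S hS, Matrix.mul_apply]
      simp only [mul_comm]
    simp [← Finset.sum_smul, hone, Matrix.one_apply]
  have hrest (l : ι) : ∑ j ∈ Finset.univ.erase i, S j l • θ j ∈ K :=
    K.sum_mem fun j hj => K.smul_mem _ (hθ j (Finset.ne_of_mem_erase hj).symm)
  have hsplit (l : ι) : v l = S i l • θ i + ∑ j ∈ Finset.univ.erase i, S j l • θ j := by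
    rw [hexpand, Finset.add_sum_erase _ (fun j => S j l • θ j) (Finset.mem_univ i)]
  have hθi : θ i ∈ K := by
    rw [hsplit, hSk, one_smul] at hk
    exact (K.add_mem_iff_left (hrest k)).mp hk
  rw [hsplit]
  exact K.add_mem (K.smul_mem _ hθi) (hrest l)

/-- sufficiency: if the control matrix `F = S⁻¹ Λ S` (with `S` invertible and
row-normalized) satisfies `N dF = F dF`, and the eigenvalues are pairwise distinct
(differences are units) with `N (d λ_i) = λ_i • d λ_i`, then `S` is a Stäckel matrix:
`N (d S_{ij}) = λ_i • d S_{ij}`. -/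
theorem stmt_8 {A : Type*} [CommRing A] {Ω : Type*} [AddCommGroup Ω] [Module A Ω]
    (d : A →+ Ω) (hd : ∀ f g : A, d (f * g) = f • d g + g • d f)
    (N : Ω →ₗ[A] Ω) (n : ℕ) (hn : 1 ≤ n) (lam : Fin n → A)
    (hdist : ∀ i j, i ≠ j → IsUnit (lam i - lam j))
    (hlam : ∀ i, N (d (lam i)) = lam i • d (lam i))
    (S : Matrix (Fin n) (Fin n) A) (hS : IsUnit S.det)
    (hnorm : ∀ i, ∃ k, S i k = 1)
    (hF : ∀ i j, N (d ((S⁻¹ * Matrix.diagonal lam * S) i j)) =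
      ∑ k, (S⁻¹ * Matrix.diagonal lam * S) i k • d ((S⁻¹ * Matrix.diagonal lam * S) k j)) :
    ∀ i j, N (d (S i j)) = lam i • d (S i j) := by
  intro i
  obtain ⟨k, hk⟩ := hnorm i
  let K : Submodule A Ω := LinearMap.ker (N - lam i • LinearMap.id)
  have hK (ω : Ω) : ω ∈ K ↔ N ω = lam i • ω := by simp [K, sub_eq_zero]
  have hFS : S⁻¹ * Matrix.diagonal lam * S * S⁻¹ = S⁻¹ * Matrix.diagonal lam :=
    Matrix.mul_nonsing_inv_cancel_right _ _ hS
  have hSF : S * (S⁻¹ * Matrix.diagonal lam * S) = Matrix.diagonal lam * S := by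
    rw [Matrix.mul_assoc, Matrix.mul_nonsing_inv_cancel_left _ _ hS]
  generalize S⁻¹ * Matrix.diagonal lam * S = F at hF hFS hSF
  have hrow (l : Fin n) : ∑ m, S i m * F m l = lam i * S i l := by
    rw [← Matrix.mul_apply, hSF, Matrix.diagonal_mul]
  have hSdF (l : Fin n) : ∑ m, S i m • d (F m l) ∈ K := by
    rw [hK]
    simp only [map_sum, map_smul, hF, Finset.smul_sum, smul_smul]
    rw [Finset.sum_comm]
    simp only [← Finset.sum_smul, hrow]
  have hdS (l : Fin n) : lam i • d (S i l) - ∑ m, F m l • d (S i m) ∈ K := by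
    have hLeibniz := congrArg d (hrow l)
    simp only [map_sum, hd, Finset.sum_add_distrib] at hLeibniz
    have hsub : lam i • d (S i l) - ∑ m, F m l • d (S i m) =
        ∑ m, S i m • d (F m l) - S i l • d (lam i) := by
      rw [sub_eq_sub_iff_add_eq_add, ← hLeibniz]
    rw [hsub]
    exact K.sub_mem (hSdF l) (K.smul_mem _ ((hK _).mpr (hlam i)))
  have hone : d 1 = 0 := by simpa using hd 1 1
  intro j
  rw [← hK]
  exact mem_of_smul_sub_sum_smul_mem K lam S F hS hFS i k (hdist i) (fun l => d (S i l)) hdS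
    (by simp [hk, hone]) hk j
end

section
/- Let A be a commutative ring, Ω an A-module, d : A → Ω an additive map satisfying the Leibniz rule d(fg) = f·d(g) + g·d(f), and N : Ω → Ω an A-linear map. Let n ≥ 1, λ : Fin n → A, and S an invertible n×n matrix over A with N(d(S i j)) = λ i • d(S i j) for all i, j. Set F := S⁻¹ * D * S, where D is the diagonal matrix with diagonal entries λ. If H : Fin n → A satisfies N(d(H i)) = Σ_j (F i j) • d(H j) for every i, then U := S.mulVec H satisfies N(d(U i)) = λ i • d(U i) for every i. -/
/-- if `S` is a Stäckel matrix and `H` has control matrix `F = S⁻¹ Λ S`,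
then `U := S H` is a Stäckel vector: `N (d U_i) = λ_i • d U_i`. -/
theorem stmt_9 {A : Type*} [CommRing A] {Ω : Type*} [AddCommGroup Ω] [Module A Ω]
    (d : A →+ Ω) (hd : ∀ f g : A, d (f * g) = f • d g + g • d f)
    (N : Ω →ₗ[A] Ω) (n : ℕ) (hn : 1 ≤ n) (lam : Fin n → A)
    (S : Matrix (Fin n) (Fin n) A) (hS : IsUnit S.det)
    (hSe : ∀ i j, N (d (S i j)) = lam i • d (S i j))
    (H : Fin n → A)
    (hH : ∀ i, N (d (H i)) = ∑ j, (S⁻¹ * Matrix.diagonal lam * S) i j • d (H j)) :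
    ∀ i, N (d (S.mulVec H i)) = lam i • d (S.mulVec H i) := by
  intro i
  have hSF : S * (S⁻¹ * Matrix.diagonal lam * S) = Matrix.diagonal lam * S := by
    rw [Matrix.mul_assoc, Matrix.mul_nonsing_inv_cancel_left _ _ hS]
  have hdH : ∑ j, S i j • N (d (H j)) = ∑ k, lam i • S i k • d (H k) := by
    simp_rw [hH, Finset.smul_sum, smul_smul]
    rw [Finset.sum_comm]
    refine Finset.sum_congr rfl fun k _ => ?_
    rw [← Finset.sum_smul, ← Matrix.mul_apply, hSF, Matrix.diagonal_mul]
  have hdU : d (S.mulVec H i) = ∑ j, S i j • d (H j) + ∑ j, H j • d (S i j) := by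
    simp only [Matrix.mulVec, dotProduct, map_sum, hd, Finset.sum_add_distrib]
  rw [hdU, map_add, map_sum, map_sum, smul_add, Finset.smul_sum, Finset.smul_sum]
  simp_rw [map_smul, hSe]
  rw [hdH]
  congr 1
  exact Finset.sum_congr rfl fun j _ => smul_comm _ _ _
end

section
/- Let R be a commutative ring and n ≥ 1. In the multivariate polynomial ring R[X_1, …, X_n], define c_i := (−1)^{i+1} e_i for 1 ≤ i ≤ n, where e_i is the i-th elementary symmetric polynomial in X_1, …, X_n, and set c_{n+1} := 0. Then for every 1 ≤ i ≤ n and every variable index j, X_j · ∂c_i/∂X_j = ∂c_{i+1}/∂X_j + c_i · ∂c_1/∂X_j. -/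
namespace MvPolynomial

open Finset

variable {σ R : Type*} [CommSemiring R]

theorem pderiv_prod_X_of_notMem {s : Finset σ} {j : σ} (h : j ∉ s) :
    pderiv j (∏ i ∈ s, (X i : MvPolynomial σ R)) = 0 := by
  classical
  rcases subsingleton_or_nontrivial R with _ | _
  · exact Subsingleton.elim _ _
  refine pderiv_eq_zero_of_notMem_vars fun hj => h ?_
  obtain ⟨i, hi, hji⟩ := Finset.mem_biUnion.mp (vars_prod (fun i => (X i : MvPolynomial σ R)) hj)
  rw [vars_X, Finset.mem_singleton] at hji
  exact hji ▸ hi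

/-- Splitting the subsets of `σ` according to whether they contain `j`. -/
theorem esymm_succ_eq_add_X_mul [Fintype σ] [DecidableEq σ] (j : σ) (k : ℕ) :
    esymm σ R (k + 1) =
      ∑ t ∈ powersetCard (k + 1) (univ.erase j), ∏ i ∈ t, X i +
        X j * ∑ t ∈ powersetCard k (univ.erase j), ∏ i ∈ t, X i := by
  have hj : j ∉ (univ : Finset σ).erase j := notMem_erase j univ
  have hmem {m : ℕ} {t : Finset σ} (ht : t ∈ powersetCard m (univ.erase j)) : j ∉ t :=
    fun h => hj ((mem_powersetCard.mp ht).1 h)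
  rw [esymm, ← insert_erase (mem_univ j), powersetCard_succ_insert hj, sum_union, sum_image,
    mul_sum, erase_insert hj]
  · exact congrArg _ (sum_congr rfl fun t ht => prod_insert (hmem ht))
  · intro s hs t ht hst
    rw [← erase_insert (hmem hs), hst, erase_insert (hmem ht)]
  · refine disjoint_left.mpr fun t ht ht' => hmem ht ?_
    obtain ⟨s, -, rfl⟩ := mem_image.mp ht'
    exact mem_insert_self j s

theorem pderiv_esymm_succ [Fintype σ] [DecidableEq σ] (j : σ) (k : ℕ) :
    pderiv j (esymm σ R (k + 1)) =
      ∑ t ∈ powersetCard k (univ.erase j), ∏ i ∈ t, X i := by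
  have h (m : ℕ) : pderiv j
      (∑ t ∈ powersetCard m (univ.erase j), ∏ i ∈ t, (X i : MvPolynomial σ R)) = 0 := by
    rw [map_sum]
    exact sum_eq_zero fun t ht => pderiv_prod_X_of_notMem fun hjt =>
      notMem_erase j univ ((mem_powersetCard.mp ht).1 hjt)
  rw [esymm_succ_eq_add_X_mul j, map_add, pderiv_mul, h, h, pderiv_X_self]
  simp

theorem esymm_succ_eq_pderiv_add_X_mul_pderiv [Fintype σ] (j : σ) (k : ℕ) :
    esymm σ R (k + 1) =
      pderiv j (esymm σ R (k + 2)) + X j * pderiv j (esymm σ R (k + 1)) := by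
  classical
  rw [pderiv_esymm_succ, pderiv_esymm_succ, ← esymm_succ_eq_add_X_mul]

theorem pderiv_esymm_one [Fintype σ] (j : σ) : pderiv j (esymm σ R 1) = 1 := by
  classical
  simp

theorem esymm_eq_zero_of_card_lt [Fintype σ] {k : ℕ} (h : Fintype.card σ < k) :
    esymm σ R k = 0 := by
  rw [esymm, powersetCard_eq_empty.mpr (by simpa using h), sum_empty]

end MvPolynomial

/-- the coefficients `c_i = (−1)^{i+1} e_i` of the minimal polynomial
`Δ(λ) = ∏ (λ − X_j)`, as polynomials in the eigenvalues `X_j`, satisfy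
`X_j · ∂c_i/∂X_j = ∂c_{i+1}/∂X_j + c_i · ∂c_1/∂X_j` for `1 ≤ i ≤ n` (with `c_{n+1} = 0`). -/
theorem stmt_10 {R : Type*} [CommRing R] (n : ℕ) (hn : 1 ≤ n)
    (c : ℕ → MvPolynomial (Fin n) R)
    (hc : ∀ i, 1 ≤ i → i ≤ n →
      c i = (-1 : MvPolynomial (Fin n) R) ^ (i + 1) * MvPolynomial.esymm (Fin n) R i)
    (hc' : c (n + 1) = 0) :
    ∀ i, 1 ≤ i → i ≤ n → ∀ j : Fin n,
      MvPolynomial.X j * MvPolynomial.pderiv j (c i) =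
        MvPolynomial.pderiv j (c (i + 1)) + c i * MvPolynomial.pderiv j (c 1) := by
  intro i hi hin j
  have hc_succ : c (i + 1) = (-1 : MvPolynomial (Fin n) R) ^ (i + 2) *
      MvPolynomial.esymm (Fin n) R (i + 1) := by
    rcases hin.lt_or_eq with h | rfl
    · exact hc (i + 1) (by omega) h
    · rw [hc', MvPolynomial.esymm_eq_zero_of_card_lt (by simp), mul_zero]
  have hpderiv (m : ℕ) (p : MvPolynomial (Fin n) R) :
      MvPolynomial.pderiv j ((-1) ^ m * p) = (-1) ^ m * MvPolynomial.pderiv j p := by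
    rcases neg_one_pow_eq_or (MvPolynomial (Fin n) R) m with h | h <;> simp [h]
  have hesymm := MvPolynomial.esymm_succ_eq_pderiv_add_X_mul_pderiv (R := R) j (i - 1)
  rw [show i - 1 + 2 = i + 1 by omega, Nat.sub_add_cancel hi] at hesymm
  rw [hc_succ, hc i hi hin, hc 1 le_rfl hn, hpderiv, hpderiv, hpderiv,
    MvPolynomial.pderiv_esymm_one]
  linear_combination (-1) ^ i * hesymm
end

section
/- Let A be a commutative ring, k ≥ 1, and n_1, …, n_k ≥ 1 with n = n_1 + ⋯ + n_k. Given elements z a b i ∈ A for a, b ∈ Fin k and i ∈ {1, …, n_a}, let F be the n×n matrix over A whose rows and columns are indexed by pairs (a, i) with a ∈ Fin k and 1 ≤ i ≤ n_a, defined by: F (a,i) (a,i+1) = 1 for 1 ≤ i ≤ n_a − 1, F (a,i) (b,1) = −(z a b i) for all a, b, i, and all other entries 0. Let 𝖥 be the k×k matrix with entries in the polynomial ring A[X] given by 𝖥 a b = δ_{ab}·X^{n_a} + Σ_{i=1}^{n_a} (z a b i)·X^{n_a − i}. Then det 𝖥 equals the characteristic polynomial det(X·I − F) of F. -/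
/-- The determinant of a matrix that is triangular with respect to an injective labelling of its
indices is the product of its diagonal entries. -/
theorem Matrix.BlockTriangular.det_eq_prod_of_injective {R m α : Type*} [CommRing R] [Fintype m]
    [DecidableEq m] [LinearOrder α] {M : Matrix m m R} {b : m → α}
    (hM : M.BlockTriangular b) (hb : Function.Injective b) : M.det = ∏ i, M i i := by
  let _ : LinearOrder m := LinearOrder.lift' b hb
  have h : M.BlockTriangular id := fun i j hij => hM hij
  convert Matrix.det_of_isUpperTriangular h

namespace ControlMatrix

open Polynomial

variable {A : Type*} [CommRing A] {k : ℕ} {nn : Fin k → ℕ}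

/-- The label of an index `(a, i)` that orders indices first by `i`, then by `a`. -/
def label (p : (a : Fin k) × Fin (nn a)) : ℕ ×ₗ Fin k := toLex (p.2.val, p.1)

theorem label_injective : Function.Injective (label (nn := nn)) := by
  rintro ⟨a, i⟩ ⟨b, j⟩ h
  have h' := congrArg ofLex h
  simp only [label, ofLex_toLex, Prod.mk.injEq] at h'
  obtain ⟨h1, rfl⟩ := h'
  rw [Fin.ext h1]

theorem snd_le_of_label_lt {p q : (a : Fin k) × Fin (nn a)} (h : label q < label p) :
    q.2.val ≤ p.2.val ∧ q ≠ p := by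
  refine ⟨?_, fun e => (e ▸ h).false⟩
  rcases Prod.Lex.toLex_lt_toLex.mp h with h | h
  · exact h.le
  · exact h.1.le

variable (A nn) in
/-- The row operation replacing, in each block `a`, the first row by the combination of the rows
`(a, i)` with coefficients `X ^ (nn a - 1 - i)`. -/
noncomputable def rowOp : Matrix ((a : Fin k) × Fin (nn a)) ((a : Fin k) × Fin (nn a)) A[X] :=
  fun p q =>
    if p.2.val = 0 then (if p.1 = q.1 then X ^ (nn q.1 - 1 - q.2.val) else 0)
    else if p = q then 1 else 0

theorem prod_fin_ite_zero {M : Type*} [CommMonoid M] {n : ℕ} (hn : 1 ≤ n) (x : M) :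
    (∏ i : Fin n, if i.val = 0 then 1 else x) = x ^ (n - 1) := by
  obtain ⟨m, rfl⟩ := Nat.exists_eq_add_of_le' hn
  simp [Fin.prod_univ_succ]

theorem prod_ite_first (hnn : ∀ a, 1 ≤ nn a) :
    (∏ p : (a : Fin k) × Fin (nn a), if p.2.val = 0 then (1 : A[X]) else X) =
      ∏ a, X ^ (nn a - 1) := by
  rw [Fintype.prod_sigma]
  refine Finset.prod_congr rfl fun a _ => ?_
  exact prod_fin_ite_zero (hnn a) X

theorem det_rowOp (hnn : ∀ a, 1 ≤ nn a) : (rowOp A nn).det = ∏ a, X ^ (nn a - 1) := by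
  have h : (rowOp A nn).BlockTriangular label := by
    intro p q hpq
    obtain ⟨h1, h2⟩ := snd_le_of_label_lt hpq
    unfold rowOp
    by_cases h0 : p.2.val = 0
    · rw [if_pos h0, if_neg]
      intro e
      refine h2 (label_injective ?_)
      simp only [label, e]
      rw [show q.2.val = p.2.val by omega]
    · rw [if_neg h0, if_neg h2.symm]
  rw [h.det_eq_prod_of_injective label_injective, Fintype.prod_sigma]
  refine Finset.prod_congr rfl fun a _ => ?_
  simp only [rowOp, if_true]
  have := hnn a
  generalize nn a = n at *
  obtain ⟨m, rfl⟩ := Nat.exists_eq_add_of_le' this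
  simp

theorem rowOp_mul_first (M : Matrix ((a : Fin k) × Fin (nn a)) ((a : Fin k) × Fin (nn a)) A[X])
    {p : (a : Fin k) × Fin (nn a)} (hp : p.2.val = 0) (q : (a : Fin k) × Fin (nn a)) :
    (rowOp A nn * M) p q = ∑ i : Fin (nn p.1), X ^ (nn p.1 - 1 - i.val) * M ⟨p.1, i⟩ q := by
  rw [Matrix.mul_apply, Fintype.sum_sigma, Finset.sum_eq_single p.1]
  · simp [rowOp, hp]
  · intro b _ hb
    simp [rowOp, hp, hb.symm]
  · simp

theorem rowOp_mul_of_ne (M : Matrix ((a : Fin k) × Fin (nn a)) ((a : Fin k) × Fin (nn a)) A[X])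
    {p : (a : Fin k) × Fin (nn a)} (hp : p.2.val ≠ 0) (q : (a : Fin k) × Fin (nn a)) :
    (rowOp A nn * M) p q = M p q := by
  rw [Matrix.mul_apply]
  simp [rowOp, hp]

/-- The indices in first position of their block are in bijection with the blocks. -/
def firstEquiv (hnn : ∀ a, 1 ≤ nn a) :
    Fin k ≃ {p : (a : Fin k) × Fin (nn a) // p.2.val = 0} where
  toFun a := ⟨⟨a, ⟨0, hnn a⟩⟩, rfl⟩
  invFun p := p.1.1
  left_inv _ := rfl
  right_inv := by
    rintro ⟨⟨a, i⟩, h⟩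
    exact Subtype.ext (congrArg (Sigma.mk a) (Fin.ext h.symm))

end ControlMatrix


/-- the determinant of the polynomial control matrix `𝖥(λ)` (here `Fpoly`)
of a Gel'fand–Zakharevich system equals the characteristic polynomial of the block
control matrix `F`. (Rows/columns of `F` are indexed by pairs `(a, i)` with `a : Fin k`,
`i : Fin (nn a)`, 0-based, so `i` stands for the paper's index `i+1`.) -/
theorem stmt_13 {A : Type*} [CommRing A] (k : ℕ) (hk : 1 ≤ k)
    (nn : Fin k → ℕ) (hnn : ∀ a, 1 ≤ nn a)
    (z : (a : Fin k) → Fin k → Fin (nn a) → A)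
    (F : Matrix ((a : Fin k) × Fin (nn a)) ((a : Fin k) × Fin (nn a)) A)
    (hF : ∀ p q : (a : Fin k) × Fin (nn a),
      F p q = if q.2.val = 0 then -(z p.1 q.1 p.2)
        else if p.1 = q.1 ∧ q.2.val = p.2.val + 1 then 1 else 0)
    (Fpoly : Matrix (Fin k) (Fin k) (Polynomial A))
    (hFpoly : ∀ a b, Fpoly a b = (if a = b then Polynomial.X ^ (nn a) else 0) +
      ∑ i : Fin (nn a), Polynomial.C (z a b i) * Polynomial.X ^ (nn a - 1 - i.val)) :
    Fpoly.det = F.charpoly := by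
  have hcol : ∀ p q : (a : Fin k) × Fin (nn a), p.2.val = 0 → q.2.val ≠ 0 →
      (ControlMatrix.rowOp A nn * F.charmatrix) p q = 0 := by
    rintro ⟨a, i⟩ ⟨b, j⟩ hp hq
    simp only at hq
    rw [ControlMatrix.rowOp_mul_first _ hp]
    simp only [Matrix.charmatrix_apply, hF, Matrix.diagonal_apply, hq, if_false]
    by_cases hab : a = b
    · subst hab
      have hj := j.isLt
      let j' : Fin (nn a) := ⟨j.val - 1, by omega⟩
      have h1 : ∀ x : Fin (nn a), (j.val = x.val + 1) ↔ x = j' := by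
        intro x
        simp only [Fin.ext_iff, j']
        omega
      simp only [h1, mul_sub, Finset.sum_sub_distrib, Sigma.mk.injEq, heq_eq_eq, true_and,
        mul_ite, mul_zero, apply_ite Polynomial.C, map_one, map_zero, mul_one,
        Finset.sum_ite_eq', Finset.mem_univ, if_true]
      rw [← pow_succ, sub_eq_zero]
      congr 1
      simp only [j']
      omega
    · simp [hab]
  have hfirst : ∀ a b, (ControlMatrix.rowOp A nn * F.charmatrix) ⟨a, ⟨0, hnn a⟩⟩ ⟨b, ⟨0, hnn b⟩⟩ =
      Fpoly a b := by
    intro a b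
    have ha := hnn a
    rw [ControlMatrix.rowOp_mul_first _ rfl, hFpoly]
    simp only [Matrix.charmatrix_apply, hF, Matrix.diagonal_apply, if_true, map_neg, sub_neg_eq_add,
      mul_add, Finset.sum_add_distrib]
    congr 1
    · by_cases hab : a = b
      · subst hab
        simp only [Sigma.mk.injEq, heq_eq_eq, true_and, mul_ite, mul_zero, Finset.sum_ite_eq',
          Finset.mem_univ, if_true, ← pow_succ]
        congr 1
        omega
      · simp [hab]
    · exact Finset.sum_congr rfl fun i _ => mul_comm _ _
  have hdet : (ControlMatrix.rowOp A nn * F.charmatrix).det = Fpoly.det * ∏ a, Polynomial.X ^ (nn a - 1) := by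
    rw [Matrix.twoBlockTriangular_det' _ (fun p => p.2.val = 0)
      fun p hp q hq => hcol p q hp hq]
    congr 1
    · rw [← Matrix.det_submatrix_equiv_self (ControlMatrix.firstEquiv hnn)]
      congr 1
      ext1 a b
      exact hfirst a b
    · have h : (Matrix.toSquareBlockProp (ControlMatrix.rowOp A nn * F.charmatrix)
          (fun p => ¬ p.2.val = 0)).BlockTriangular (fun p => ControlMatrix.label p.1) := by
        rintro ⟨p, hp⟩ ⟨q, hq⟩ hpq
        obtain ⟨h1, h2⟩ := ControlMatrix.snd_le_of_label_lt hpq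
        rw [Matrix.toSquareBlockProp_def, Matrix.of_apply, ControlMatrix.rowOp_mul_of_ne _ hp,
          Matrix.charmatrix_apply_ne _ _ _ h2.symm, hF, if_neg hq, if_neg (by omega)]
        simp
      rw [h.det_eq_prod_of_injective (ControlMatrix.label_injective.comp Subtype.val_injective),
        ← ControlMatrix.prod_ite_first hnn, Finset.prod_ite, Finset.prod_const_one, one_mul,
        ← Finset.prod_subtype_eq_prod_filter, Finset.subtype_univ]
      refine Finset.prod_congr rfl ?_
      rintro ⟨p, hp⟩ -
      rw [Matrix.toSquareBlockProp_def, Matrix.of_apply, ControlMatrix.rowOp_mul_of_ne _ hp,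
        Matrix.charmatrix_apply_eq, hF, if_neg hp, if_neg (by omega)]
      simp
  have hreg : IsRightRegular (∏ a, (Polynomial.X : Polynomial A) ^ (nn a - 1)) :=
    (Polynomial.monic_prod_of_monic _ _ fun a _ => Polynomial.monic_X_pow _).isRegular.right
  refine hreg ?_
  simp only
  rw [← hdet, Matrix.det_mul, ControlMatrix.det_rowOp hnn, Matrix.charpoly, mul_comm]
end

section
/- Let K be a field, k ≥ 1, and M a k×k matrix with entries in the polynomial ring K[X]. Suppose λ₀ ∈ K is a root of det M of multiplicity exactly one, i.e. (X − λ₀) divides det M but (X − λ₀)² does not. Then the matrix M(λ₀) over K obtained by evaluating every entry of M at λ₀ has kernel of dimension exactly 1 (equivalently, rank k − 1). -/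
namespace Matrix

open Polynomial

/-- A square matrix over a field whose kernel has dimension at least two has zero adjugate. -/
theorem adjugate_eq_zero_of_one_lt_finrank_ker {K n : Type*} [Field K] [Fintype n]
    [DecidableEq n] (A : Matrix n n K)
    (hA : 1 < Module.finrank K (LinearMap.ker (toLin' A))) : A.adjugate = 0 := by
  ext i j
  rw [adjugate_apply, zero_apply, ← exists_mulVec_eq_zero_iff]
  let f : LinearMap.ker (toLin' A) →ₗ[K] K :=
    (LinearMap.proj i).comp (LinearMap.ker (toLin' A)).subtype
  have hf : LinearMap.ker f ≠ ⊥ :=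
    LinearMap.ker_ne_bot_of_finrank_lt (by rwa [Module.finrank_self])
  obtain ⟨v, hv, hv0⟩ := Submodule.exists_mem_ne_zero_of_ne_bot hf
  refine ⟨v, fun h => hv0 (Subtype.ext h), ?_⟩
  have hAv : A *ᵥ (v : n → K) = 0 := LinearMap.mem_ker.mp v.2
  ext r
  by_cases hr : r = j
  · subst hr
    simpa [mulVec, f] using hv
  · simpa [mulVec, updateRow_ne hr] using congrFun hAv r

/-- If `X - C a` divides both the determinant and every entry of the adjugate of a polynomial
matrix, then `(X - C a) ^ 2` divides the determinant. -/
theorem sq_X_sub_C_dvd_det {K n : Type*} [Field K] [Fintype n] [DecidableEq n]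
    (M : Matrix n n K[X]) (a : K) (hdet : (X - C a) ∣ M.det)
    (hadj : ∀ i j, (X - C a) ∣ M.adjugate i j) : (X - C a) ^ 2 ∣ M.det := by
  obtain ⟨q, hq⟩ := id hdet
  choose N hN using hadj
  have hadjN : M.adjugate = (X - C a) • of N := by
    ext1 i j
    exact hN i j
  have hMN : M * of N = q • (1 : Matrix n n K[X]) := by
    have h := mul_adjugate M
    rw [hadjN, hq, mul_smul_comm, mul_smul] at h
    exact smul_right_injective _ (X_sub_C_ne_zero a) h
  have hpow : (X - C a) ∣ q ^ Fintype.card n := by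
    have h := congrArg det hMN
    rw [det_mul, det_smul, det_one, mul_one] at h
    exact h ▸ hdet.mul_right _
  rw [hq, sq]
  exact mul_dvd_mul_left _ ((prime_X_sub_C a).dvd_of_dvd_pow hpow)

end Matrix

/-- if `λ₀` is a simple root of the determinant of a polynomial matrix `M`,
then the evaluated matrix `M(λ₀)` has one-dimensional kernel. -/
theorem stmt_14 {K : Type*} [Field K] (k : ℕ) (hk : 1 ≤ k)
    (M : Matrix (Fin k) (Fin k) (Polynomial K)) (lam0 : K)
    (h1 : (Polynomial.X - Polynomial.C lam0) ∣ M.det)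
    (h2 : ¬ (Polynomial.X - Polynomial.C lam0) ^ 2 ∣ M.det) :
    Module.finrank K
      (LinearMap.ker (Matrix.toLin' (M.map (Polynomial.eval lam0)))) = 1 := by
  apply le_antisymm
  · by_contra! hlt
    refine h2 (M.sq_X_sub_C_dvd_det lam0 h1 fun i j => ?_)
    have hadj : (Polynomial.evalRingHom lam0).mapMatrix M.adjugate = 0 := by
      rw [RingHom.map_adjugate]
      exact Matrix.adjugate_eq_zero_of_one_lt_finrank_ker _ hlt
    exact Polynomial.dvd_iff_isRoot.mpr (congrFun (congrFun hadj i) j)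
  · have hdet : (M.map (Polynomial.eval lam0)).det = 0 :=
      ((Polynomial.evalRingHom lam0).map_det M).symm.trans (Polynomial.dvd_iff_isRoot.mp h1)
    obtain ⟨v, hv0, hv⟩ := Matrix.exists_mulVec_eq_zero_iff.mpr hdet
    rw [Submodule.one_le_finrank_iff]
    exact (Submodule.ne_bot_iff _).mpr ⟨v, by simpa using hv, hv0⟩
end

section
/- Let A be a commutative ring, Ω an A-module, d : A → Ω an additive map satisfying the Leibniz rule d(fg) = f·d(g) + g·d(f), and N : Ω → Ω an A-linear map. Let k ≥ 1, r, h : Fin k → A, λ₀ ∈ A, M a k×k matrix over A, and u : Fin k → Ω. Suppose: (i) Σ_a (r a)·(M a b) = 0 for every b; (ii) N(d(r a)) = λ₀ • d(r a) for every a; and (iii) N(d(h a)) = λ₀ • d(h a) − Σ_b (M a b) • (u b) for every a. Then N( d( Σ_a (r a)·(h a) ) ) = λ₀ • d( Σ_a (r a)·(h a) ). -/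
/-- if `r` annihilates `M` on the left, each `r a` is a Stäckel function
relative to `λ₀`, and `(N − λ₀) d(h a) = −∑_b M a b • u b`, then `∑_a r a · h a` is a
Stäckel function relative to `λ₀`. -/
theorem stmt_15 {A : Type*} [CommRing A] {Ω : Type*} [AddCommGroup Ω] [Module A Ω]
    (d : A →+ Ω) (hd : ∀ f g : A, d (f * g) = f • d g + g • d f)
    (N : Ω →ₗ[A] Ω) (k : ℕ) (hk : 1 ≤ k)
    (r h : Fin k → A) (lam0 : A)
    (M : Matrix (Fin k) (Fin k) A) (u : Fin k → Ω)
    (h1 : ∀ b, ∑ a, r a * M a b = 0)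
    (h2 : ∀ a, N (d (r a)) = lam0 • d (r a))
    (h3 : ∀ a, N (d (h a)) = lam0 • d (h a) - ∑ b, M a b • u b) :
    N (d (∑ a, r a * h a)) = lam0 • d (∑ a, r a * h a) := by
  have hu : ∑ a, r a • ∑ b, M a b • u b = 0 := by
    simp_rw [Finset.smul_sum, smul_smul]
    rw [Finset.sum_comm]
    simp_rw [← Finset.sum_smul, h1, zero_smul, Finset.sum_const_zero]
  have hterm (a : Fin k) :
      N (d (r a * h a)) = lam0 • d (r a * h a) - r a • ∑ b, M a b • u b := by
    rw [hd, map_add, map_smul, map_smul, h2, h3, smul_sub, smul_add,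
      smul_comm (r a) lam0, smul_comm (h a) lam0]
    abel
  simp_rw [map_sum, hterm, Finset.sum_sub_distrib, hu, sub_zero, Finset.smul_sum]
end

section
/- Work in the polynomial ring A = MvPolynomial (Fin 6) ℚ with variables a₁, a₂, b₁, b₂, b₃, λ. Define the 5×5 matrix P over A (rows and columns ordered to correspond to the coordinates a₁, a₂, b₁, b₂, b₃): P = [[0, −a₁a₂, (b₁−λ)a₁, (λ−b₂)a₁, 0], [a₁a₂, 0, 0, (b₂−λ)a₂, (λ−b₃)a₂], [(λ−b₁)a₁, 0, 0, a₁, 0], [(b₂−λ)a₁, (λ−b₂)a₂, −a₁, 0, a₂], [0, (b₃−λ)a₂, 0, −a₂, 0]]. Define H := (b₁+b₂+b₃)·λ² − (b₁b₂ + b₂b₃ + b₃b₁ + a₁ + a₂)·λ + (b₁b₂b₃ + a₁b₃ + a₂b₁), and let ∇H be the vector of the five partial derivatives of H with respect to a₁, a₂, b₁, b₂, b₃ (in that order). Then P.mulVec ∇H = 0, i.e. H(λ) is a Casimir function of the Poisson pencil P_λ. -/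
noncomputable section

open MvPolynomial

/-- The polynomial ring in the Flaschka–Manakov variables `a₁, a₂, b₁, b₂, b₃`
(indices 0–4) and the pencil parameter `λ` (index 5). -/
abbrev TodaRing : Type := MvPolynomial (Fin 6) ℚ

def ta1 : TodaRing := X 0
def ta2 : TodaRing := X 1
def tb1 : TodaRing := X 2
def tb2 : TodaRing := X 3
def tb3 : TodaRing := X 4
def tlam : TodaRing := X 5

/-- The Poisson pencil `P_λ = P' − λP` of the 3-particle open Toda lattice in
Flaschka–Manakov coordinates. -/
def todaP : Matrix (Fin 5) (Fin 5) TodaRing :=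
  !![0, -ta1 * ta2, (tb1 - tlam) * ta1, (tlam - tb2) * ta1, 0;
     ta1 * ta2, 0, 0, (tb2 - tlam) * ta2, (tlam - tb3) * ta2;
     (tlam - tb1) * ta1, 0, 0, ta1, 0;
     (tb2 - tlam) * ta1, (tlam - tb2) * ta2, -ta1, 0, ta2;
     0, (tb3 - tlam) * ta2, 0, -ta2, 0]

/-- The polynomial Casimir `H(λ) = H₀λ² + H₁λ + H₂`. -/
def todaH : TodaRing :=
  (tb1 + tb2 + tb3) * tlam ^ 2
    - (tb1 * tb2 + tb2 * tb3 + tb3 * tb1 + ta1 + ta2) * tlam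
    + (tb1 * tb2 * tb3 + ta1 * tb3 + ta2 * tb1)

/-- The gradient of `H(λ)` with respect to `a₁, a₂, b₁, b₂, b₃`. -/
def todaGradH : Fin 5 → TodaRing :=
  ![pderiv 0 todaH, pderiv 1 todaH, pderiv 2 todaH, pderiv 3 todaH, pderiv 4 todaH]

lemma todaGradH_eq : todaGradH =
    ![tb3 - tlam, tb1 - tlam, (tlam - tb2) * (tlam - tb3) + ta2,
      (tlam - tb1) * (tlam - tb3), (tlam - tb1) * (tlam - tb2) + ta1] := by
  ext1 i
  fin_cases i <;>
    simp [todaGradH, todaH, ta1, ta2, tb1, tb2, tb3, tlam, pderiv_X] <;>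
    ring

/-- `H(λ)` is a Casimir of the Toda Poisson pencil: `P_λ dH(λ) = 0`. -/
theorem stmt_16 : todaP.mulVec todaGradH = 0 := by
  rw [todaGradH_eq]
  ext1 i
  fin_cases i <;>
    simp [todaP, Matrix.mulVec, dotProduct, Fin.sum_univ_five] <;>
    ring

end
end

section
/- Let K be a field containing ℚ and let L be a 3×3 matrix over K with trace L = 0. Suppose the (3,1) entry L₃₁ is nonzero and that L₃₂·(L²)₃₁ = L₃₁·(L²)₃₂, where (L²)ᵢⱼ denotes the (i,j) entry of L². Set μ := −(L²)₃₁ / L₃₁. Then det(μ·I − L) = 0; equivalently, μ³ − (1/2)·tr(L²)·μ − (1/3)·tr(L³) = 0, i.e. the pair (with this μ) lies on the spectral curve of L. -/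
/-- The characteristic polynomial of a traceless `3 × 3` matrix in terms of traces of powers. -/
theorem det_smul_one_sub_fin_three_of_trace_eq_zero {K : Type*} [Field K] [CharZero K]
    (L : Matrix (Fin 3) (Fin 3) K) (htr : Matrix.trace L = 0) (μ : K) :
    Matrix.det (μ • (1 : Matrix (Fin 3) (Fin 3) K) - L) =
      μ ^ 3 - (1 / 2 : K) * Matrix.trace (L * L) * μ
        - (1 / 3 : K) * Matrix.trace (L * L * L) := by
  rw [Matrix.trace_fin_three] at htr
  have hk : L 2 2 = -L 0 0 - L 1 1 := by linear_combination htr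
  simp only [Matrix.det_fin_three, Matrix.trace_fin_three, Matrix.mul_apply, Fin.sum_univ_three,
    Matrix.sub_apply, Matrix.smul_apply, Matrix.one_apply, smul_eq_mul, hk]
  simp
  field_simp
  ring

/-- for a traceless 3×3 matrix `L` with `L₃₁ ≠ 0` satisfying
`L₃₂·(L²)₃₁ = L₃₁·(L²)₃₂`, the value `μ = −(L²)₃₁/L₃₁` lies on the spectral curve:
`det(μI − L) = 0`, equivalently `μ³ − ½ tr(L²) μ − ⅓ tr(L³) = 0`. -/
theorem stmt_18 {K : Type*} [Field K] [CharZero K]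
    (L : Matrix (Fin 3) (Fin 3) K)
    (htr : Matrix.trace L = 0) (h31 : L 2 0 ≠ 0)
    (hcon : L 2 1 * (L * L) 2 0 = L 2 0 * (L * L) 2 1) :
    Matrix.det ((-(L * L) 2 0 / L 2 0) • (1 : Matrix (Fin 3) (Fin 3) K) - L) = 0 ∧
      (-(L * L) 2 0 / L 2 0) ^ 3
        - (1 / 2 : K) * Matrix.trace (L * L) * (-(L * L) 2 0 / L 2 0)
        - (1 / 3 : K) * Matrix.trace (L * L * L) = 0 := by
  have hdet :
      Matrix.det ((-(L * L) 2 0 / L 2 0) • (1 : Matrix (Fin 3) (Fin 3) K) - L) = 0 := by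
    rw [Matrix.trace_fin_three] at htr
    simp only [Matrix.mul_apply, Fin.sum_univ_three] at hcon ⊢
    set μ := -(L 2 0 * L 0 0 + L 2 1 * L 1 0 + L 2 2 * L 2 0) / L 2 0 with hμ
    have hμ' : μ * L 2 0 = L 1 1 * L 2 0 - L 2 1 * L 1 0 := by
      rw [hμ, div_mul_cancel₀ _ h31]
      linear_combination -L 2 0 * htr
    -- the kernel of the row `(L₃₁, L₃₂)` is spanned by an eigenvector of the upper-left block
    refine Matrix.exists_mulVec_eq_zero_iff.mp ⟨![-L 2 1, L 2 0, 0], fun h => ?_, ?_⟩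
    · exact h31 (by simpa using congrFun h 1)
    · ext i
      fin_cases i <;>
        simp [Matrix.mulVec, dotProduct, Fin.sum_univ_three, Matrix.one_apply]
      · apply mul_left_cancel₀ h31
        linear_combination hcon - L 2 1 * hμ'
      · linear_combination hμ'
      · ring
  exact ⟨hdet, (det_smul_one_sub_fin_three_of_trace_eq_zero L htr _).symm.trans hdet⟩
end

section
/- Let R be a commutative ring, A a commutative R-algebra, and k ≥ 1. Let Z : Fin k → Derivation R A A be a family of R-linear derivations of A and H : Fin k → A elements such that Z a (H b) = δ_{ab} (equal to 1 if a = b and 0 otherwise). Suppose there exist φ : Fin k → Fin k → Fin k → A such that the commutator ⁅Z a, Z b⁆ (which is again a derivation) equals Σ_c (φ a b c) • (Z c), where • denotes the A-module scalar multiplication on derivations. Then φ a b c = 0 for all a, b, c; in particular ⁅Z a, Z b⁆ = 0, i.e. the normalized derivations pairwise commute. -/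
theorem Derivation.finsetSum_apply {R A M ι : Type*} [CommSemiring R] [CommSemiring A]
    [AddCommMonoid M] [Algebra R A] [Module A M] [Module R M]
    (s : Finset ι) (D : ι → Derivation R A M) (x : A) :
    (∑ i ∈ s, D i) x = ∑ i ∈ s, D i x := by
  classical
  induction s using Finset.induction_on with
  | empty => simp
  | insert i s hi ih => simp [Finset.sum_insert hi, ih]

/-- derivations normalized against functions `H b` by `Z a (H b) = δ_{ab}`
whose commutators are combinations `⁅Z a, Z b⁆ = ∑ c φ a b c • Z c` pairwise commute:
all `φ a b c = 0`, hence `⁅Z a, Z b⁆ = 0`. -/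
theorem stmt_19 {R A : Type*} [CommRing R] [CommRing A] [Algebra R A]
    (k : ℕ) (hk : 1 ≤ k)
    (Z : Fin k → Derivation R A A) (H : Fin k → A)
    (hnorm : ∀ a b, Z a (H b) = if a = b then 1 else 0)
    (φ : Fin k → Fin k → Fin k → A)
    (hbr : ∀ a b, ⁅Z a, Z b⁆ = ∑ c, φ a b c • Z c) :
    (∀ a b c, φ a b c = 0) ∧ ∀ a b, ⁅Z a, Z b⁆ = 0 := by
  have hconst : ∀ a b c, Z a (Z b (H c)) = 0 := by
    intro a b c
    rw [hnorm]
    split_ifs <;> simp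
  have hφ : ∀ a b c, φ a b c = 0 := by
    intro a b c
    have h := congrArg (fun D : Derivation R A A => D (H c)) (hbr a b)
    simp only [Derivation.commutator_apply, hconst, sub_self, Derivation.finsetSum_apply] at h
    simpa [hnorm] using h.symm
  exact ⟨hφ, fun a b => by simp [hbr, hφ]⟩
end
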